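/- arXiv:2109.01842 — 3 statements merged into one kernel-verified Lean document; each statement's English description precedes it below -/
import Mathlib

section
/- Let G be a finite group and ρ an irreducible, faithful, self-dual (ρ ≅ ρ*) finite-dimensional complex representation of G (so the McKay graph Γ(G,ρ) is connected and undirected). Then Γ(G,ρ) is bipartite — i.e. there exists ε : Irr(G) → ℤ/2ℤ with ε(λ) ≠ ε(μ) whenever [μ⊗ρ:λ] ≠ 0 — if and only if the center Z(G) has exactly 2 elements. -/
open scoped TensorProduct

/-- The dimension of the space of `G`-equivariant linear maps between two representations;
when `τ` is irreducible this is the multiplicity `[π : τ]`. -/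
noncomputable def multHom {G V W : Type} [Group G]
    [AddCommGroup V] [Module ℂ V] [AddCommGroup W] [Module ℂ W]
    (π : Representation ℂ G V) (τ : Representation ℂ G W) : ℕ :=
  Module.finrank ℂ (Representation.linHom π τ).invariants

/-- A representation is irreducible if it is nonzero and has no nontrivial invariant subspaces. -/
def IsIrreducibleRep {G V : Type} [Group G] [AddCommGroup V] [Module ℂ V]
    (ρ : Representation ℂ G V) : Prop :=
  Nontrivial V ∧ ∀ p : Submodule ℂ V, (∀ g : G, ∀ v ∈ p, ρ g v ∈ p) → p = ⊥ ∨ p = ⊤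

/-- Two representations are isomorphic if there is an equivariant linear equivalence. -/
def RepIso {G V W : Type} [Group G] [AddCommGroup V] [Module ℂ V] [AddCommGroup W] [Module ℂ W]
    (π : Representation ℂ G V) (τ : Representation ℂ G W) : Prop :=
  ∃ e : V ≃ₗ[ℂ] W, ∀ (g : G) (v : V), e (π g v) = τ g (e v)

section aux

lemma zmod2_aux : ∀ s t r : ZMod 2, s ≠ t → r ≠ s → r = t := by decide

lemma eq_zero_of_eq_neg {U : Type} [AddCommGroup U] [Module ℂ U] {u : U} (h : u = -u) : u = 0 := by
  have h2 : (2 : ℂ) • u = 0 := by rw [two_smul]; nth_rewrite 2 [h]; exact add_neg_cancel u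
  exact (smul_eq_zero.mp h2).resolve_left two_ne_zero

variable {G : Type} [Group G]

/-- Equivariance of a linear map. -/
def Eqv {U W : Type} [AddCommGroup U] [Module ℂ U] [AddCommGroup W] [Module ℂ W]
    (π : Representation ℂ G U) (τ : Representation ℂ G W) (T : U →ₗ[ℂ] W) : Prop :=
  ∀ g v, T (π g v) = τ g (T v)

lemma multHom_ne_zero_iff {U W : Type} [AddCommGroup U] [Module ℂ U] [FiniteDimensional ℂ U]
    [AddCommGroup W] [Module ℂ W] [FiniteDimensional ℂ W]
    (π : Representation ℂ G U) (τ : Representation ℂ G W) :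
    multHom π τ ≠ 0 ↔ ∃ T : U →ₗ[ℂ] W, Eqv π τ T ∧ T ≠ 0 := by
  unfold multHom
  rw [Ne, Submodule.finrank_eq_zero, ← Ne, Submodule.ne_bot_iff]
  refine exists_congr fun T => and_congr_left fun _ => ?_
  rw [Representation.mem_invariants]
  constructor
  · intro h g v
    have := LinearMap.congr_fun (h g) (π g v)
    simpa [Representation.linHom_apply] using this.symm
  · intro h g
    ext v
    simp [Representation.linHom_apply, ← h g]

lemma schur_iso {U W : Type} [AddCommGroup U] [Module ℂ U]
    [AddCommGroup W] [Module ℂ W]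
    (π : Representation ℂ G U) (τ : Representation ℂ G W)
    (hπ : IsIrreducibleRep π) (hτ : IsIrreducibleRep τ)
    (T : U →ₗ[ℂ] W) (hT : Eqv π τ T) (h0 : T ≠ 0) : RepIso π τ := by
  have hk : LinearMap.ker T = ⊥ := by
    rcases hπ.2 (LinearMap.ker T) (fun g v hv => by
      rw [LinearMap.mem_ker] at hv ⊢; rw [hT, hv, map_zero]) with h | h
    · exact h
    · exact absurd (LinearMap.ker_eq_top.mp h) h0
  have hr : LinearMap.range T = ⊤ := by
    rcases hτ.2 (LinearMap.range T) (by
      rintro g _ ⟨v, rfl⟩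
      exact ⟨π g v, hT g v⟩) with h | h
    · exact absurd (LinearMap.range_eq_bot.mp h) h0
    · exact h
  exact ⟨LinearEquiv.ofBijective T ⟨LinearMap.ker_eq_bot.mp hk, LinearMap.range_eq_top.mp hr⟩,
    fun g v => hT g v⟩

lemma schur_scalar {U : Type} [AddCommGroup U] [Module ℂ U] [FiniteDimensional ℂ U]
    (π : Representation ℂ G U) (hπ : IsIrreducibleRep π)
    (T : U →ₗ[ℂ] U) (hT : Eqv π π T) : ∃ c : ℂ, ∀ v, T v = c • v := by
  have := hπ.1
  obtain ⟨c, hc⟩ := Module.End.exists_eigenvalue T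
  refine ⟨c, ?_⟩
  rcases hπ.2 (Module.End.eigenspace T c) (fun g v hv => by
    rw [Module.End.mem_eigenspace_iff] at hv ⊢
    rw [hT, hv, map_smul]) with h | h
  · exact absurd h hc
  · intro v
    have : v ∈ Module.End.eigenspace T c := h ▸ Submodule.mem_top
    exact Module.End.mem_eigenspace_iff.mp this

lemma central_scalar {U : Type} [AddCommGroup U] [Module ℂ U] [FiniteDimensional ℂ U]
    (π : Representation ℂ G U) (hπ : IsIrreducibleRep π)
    (z : G) (hz : z ∈ Subgroup.center G) : ∃ c : ℂ, ∀ v, π z v = c • v := by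
  refine schur_scalar π hπ (π z) fun g v => ?_
  rw [← Module.End.mul_apply, ← Module.End.mul_apply, ← map_mul, ← map_mul,
    (Subgroup.mem_center_iff.mp hz g)]

/-- The matrix coefficient function. -/
def coef {U : Type} [AddCommGroup U] [Module ℂ U] (π : Representation ℂ G U)
    (l : U →ₗ[ℂ] ℂ) (v : U) : G → ℂ := fun g => l (π g v)

lemma coef_orth [Fintype G] {U W : Type} [AddCommGroup U] [Module ℂ U]
    [AddCommGroup W] [Module ℂ W]
    (π : Representation ℂ G U) (τ : Representation ℂ G W)
    (hπ : IsIrreducibleRep π) (hτ : IsIrreducibleRep τ) (hne : ¬ RepIso π τ)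
    (l : U →ₗ[ℂ] ℂ) (v : U) (m : W →ₗ[ℂ] ℂ) (w : W) :
    ∑ g : G, coef π l v g⁻¹ * coef τ m w g = 0 := by
  let S : U →ₗ[ℂ] W := ∑ g : G, (τ g) ∘ₗ (l.smulRight w) ∘ₗ (π g⁻¹)
  have hSapp : ∀ x, S x = ∑ g : G, l (π g⁻¹ x) • τ g w := by
    intro x; simp [S]
  have hS : Eqv π τ S := by
    intro h x
    rw [hSapp, hSapp, map_sum]
    refine Fintype.sum_equiv (Equiv.mulLeft h⁻¹) _ _ fun g => ?_
    simp only [Equiv.coe_mulLeft, map_smul, mul_inv_rev, inv_inv]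
    rw [← Module.End.mul_apply, ← Module.End.mul_apply, ← map_mul, ← map_mul, mul_inv_cancel_left]
  have h0 : S = 0 := by
    by_contra h
    exact hne (schur_iso π τ hπ hτ S hS h)
  have := congrArg m (hSapp v)
  rw [h0] at this
  simpa [coef] using this.symm

lemma coef_mem [Fintype G] {ι : Type}
    (W : ι → Type) [∀ i, AddCommGroup (W i)] [∀ i, Module ℂ (W i)]
    [∀ i, FiniteDimensional ℂ (W i)]
    (Irr : (i : ι) → Representation ℂ G (W i))
    (hirr : ∀ i, IsIrreducibleRep (Irr i))
    (hcompl : ∀ (U : Type) [AddCommGroup U] [Module ℂ U] [FiniteDimensional ℂ U]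
      (σ : Representation ℂ G U), IsIrreducibleRep σ → ∃ i, RepIso σ (Irr i))
    (n : ℕ) : ∀ (U : Type) [AddCommGroup U] [Module ℂ U] [FiniteDimensional ℂ U]
      (π : Representation ℂ G U), Module.finrank ℂ U = n →
      ∀ (M : Submodule ℂ (G → ℂ)),
      (∀ j, (∃ T : U →ₗ[ℂ] W j, Eqv π (Irr j) T ∧ T ≠ 0) → ∀ l w, coef (Irr j) l w ∈ M) →
      ∀ l v, coef π l v ∈ M := by
  induction n using Nat.strong_induction_on with
  | _ n ih =>
  intro U _ _ _ π hn M hM l v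
  by_cases hnt : Nontrivial U
  swap
  · rw [not_nontrivial_iff_subsingleton] at hnt
    have : coef π l v = 0 := by
      funext g
      simp [coef, Subsingleton.elim (π g v) 0]
    rw [this]; exact M.zero_mem
  by_cases hi : IsIrreducibleRep π
  · obtain ⟨j, e, he⟩ := hcompl U π hi
    have h1 := hM j ⟨e.toLinearMap, he, fun h => by
      obtain ⟨x, hx⟩ := exists_ne (0 : U)
      exact hx (e.injective (by simpa using LinearMap.congr_fun h x))⟩
      (l ∘ₗ e.symm.toLinearMap) (e v)
    convert h1 using 1
    funext g
    simp [coef, ← he]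
  · have : ∃ p : Submodule ℂ U, (∀ g : G, ∀ v ∈ p, π g v ∈ p) ∧ p ≠ ⊥ ∧ p ≠ ⊤ := by
      by_contra hcon
      push Not at hcon
      refine hi ⟨hnt, fun p hp => ?_⟩
      by_cases hb : p = ⊥
      · exact Or.inl hb
      · exact Or.inr (hcon p hp hb)
    obtain ⟨p, hp, hpb, hpt⟩ := this
    obtain ⟨q', hq'⟩ := exists_isCompl (⟨p, fun g v hv => hp g v hv⟩ : Subrepresentation π)
    obtain ⟨q, hq⟩ := q'
    have hpq : IsCompl p q := by
      constructor
      · rw [disjoint_iff]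
        have := hq'.inf_eq_bot
        exact congrArg Subrepresentation.toSubmodule this
      · rw [codisjoint_iff]
        have := hq'.sup_eq_top
        exact congrArg Subrepresentation.toSubmodule this
    have key : ∀ (p q : Submodule ℂ U) (hp : ∀ g : G, ∀ v ∈ p, π g v ∈ p)
        (hq : ∀ g : G, ∀ v ∈ q, π g v ∈ q) (hpq : IsCompl p q) (hpt : p ≠ ⊤),
        ∀ v ∈ p, coef π l v ∈ M := by
      intro p q hp hq hpq hpt v hv
      let σ : Subrepresentation π := ⟨p, fun g v hv => hp g v hv⟩
      have hlt : Module.finrank ℂ p < n := hn ▸ Submodule.finrank_lt hpt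
      refine ih _ hlt p σ.toRepresentation rfl M ?_ (l ∘ₗ p.subtype) ⟨v, hv⟩
      rintro j ⟨T, hT, hT0⟩ 
      refine hM j ⟨T ∘ₗ p.projectionOnto q hpq, ?_, ?_⟩
      · intro g x
        have hx := Submodule.mem_sup.mp (hpq.sup_eq_top ▸ Submodule.mem_top : x ∈ p ⊔ q)
        obtain ⟨a, ha, b, hb, rfl⟩ := hx
        have e1 : ∀ a (ha : a ∈ p), p.projectionOnto q hpq a = ⟨a, ha⟩ := fun a ha =>
          Submodule.projectionOnto_apply_left hpq ⟨a, ha⟩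
        have e2 : ∀ b (_ : b ∈ q), p.projectionOnto q hpq b = 0 := fun b hb =>
          Submodule.projectionOnto_apply_right hpq ⟨b, hb⟩
        simp only [LinearMap.comp_apply, map_add, e1 a ha, e1 _ (hp g a ha), e2 b hb,
          e2 _ (hq g b hb), map_zero, add_zero]
        exact hT g ⟨a, ha⟩
      · intro h
        apply hT0
        ext x
        have := LinearMap.congr_fun h (x : U)
        simpa using this
    obtain ⟨a, ha, b, hb, rfl⟩ :=
      Submodule.mem_sup.mp (hpq.sup_eq_top ▸ Submodule.mem_top : v ∈ p ⊔ q)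
    have hqt : q ≠ ⊤ := by
      rintro rfl
      exact hpb (by simpa using hpq.inf_eq_bot)
    have : coef π l (a + b) = coef π l a + coef π l b := by
      funext g; simp [coef]
    rw [this]
    exact M.add_mem (key p q hp (fun g v hv => hq g hv) hpq hpt a ha)
      (key q p (fun g v hv => hq g hv) hp hpq.symm hqt b hb)

/-- Right translation representation on functions. -/
def rightReg (G : Type) [Group G] : Representation ℂ G (G → ℂ) where
  toFun g := { toFun := fun f x => f (x * g), map_add' := fun _ _ => rfl,
               map_smul' := fun _ _ => rfl }
  map_one' := by ext; simp
  map_mul' a b := by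
    refine LinearMap.ext fun f => funext fun x => ?_
    simp [mul_assoc]

lemma exists_neg_one [Fintype G]
    {V : Type} [AddCommGroup V] [Module ℂ V] [FiniteDimensional ℂ V]
    (ρ : Representation ℂ G V)
    {ι : Type}
    (W : ι → Type) [∀ i, AddCommGroup (W i)] [∀ i, Module ℂ (W i)]
    [∀ i, FiniteDimensional ℂ (W i)]
    (Irr : (i : ι) → Representation ℂ G (W i))
    (hirr : ∀ i, IsIrreducibleRep (Irr i))
    (hdist : ∀ i j, RepIso (Irr i) (Irr j) → i = j)
    (hcompl : ∀ (U : Type) [AddCommGroup U] [Module ℂ U] [FiniteDimensional ℂ U]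
      (σ : Representation ℂ G U), IsIrreducibleRep σ → ∃ i, RepIso σ (Irr i))
    (ε : ι → ZMod 2) (hε : ∀ i j, multHom ((Irr i).tprod ρ) (Irr j) ≠ 0 → ε j ≠ ε i) :
    ∃ h : G, ∀ v, ρ h v = -v := by
  classical
  let A : ZMod 2 → Submodule ℂ (G → ℂ) := fun s =>
    Submodule.span ℂ {f | ∃ i l w, ε i = s ∧ f = coef (Irr i) l w}
  have hz : ∀ s : ZMod 2, s = 0 ∨ s = 1 := by decide
  have htop : ∀ f : G → ℂ, f ∈ A 0 ⊔ A 1 := by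
    intro f
    have := coef_mem W Irr hirr hcompl _ (G → ℂ) (rightReg G) rfl (A 0 ⊔ A 1) (by
      intro j _ l w
      rcases hz (ε j) with h | h
      · exact Submodule.mem_sup_left (Submodule.subset_span ⟨j, l, w, h, rfl⟩)
      · exact Submodule.mem_sup_right (Submodule.subset_span ⟨j, l, w, h, rfl⟩))
      (LinearMap.proj 1) f
    convert this using 1
    funext g
    simp [coef, rightReg]
  -- the bilinear form
  let B : (G → ℂ) →ₗ[ℂ] (G → ℂ) →ₗ[ℂ] ℂ :=
    LinearMap.mk₂ ℂ (fun f k => ∑ g : G, f g⁻¹ * k g)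
      (by intros; simp [add_mul, Finset.sum_add_distrib])
      (by intros; simp [mul_assoc, Finset.mul_sum])
      (by intros; simp [mul_add, Finset.sum_add_distrib])
      (by intros; simp [mul_left_comm, Finset.mul_sum])
  have hB : ∀ f k, B f k = ∑ g : G, f g⁻¹ * k g := fun f k => rfl
  have horth : ∀ s t, s ≠ t → ∀ f ∈ A s, ∀ k ∈ A t, B f k = 0 := by
    intro s t hst f hf k hk
    induction hf using Submodule.span_induction with
    | zero => simp
    | add x y _ _ hx hy => simp [hx, hy]
    | smul c x _ hx => simp [hx]
    | mem x hx =>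
      induction hk using Submodule.span_induction with
      | zero => simp
      | add x y _ _ hx hy => simp [hx, hy]
      | smul c x _ hx => simp [hx]
      | mem y hy =>
        obtain ⟨i, l, w, hi, rfl⟩ := hx
        obtain ⟨j, m, u, hj, rfl⟩ := hy
        rw [hB]
        refine coef_orth _ _ (hirr i) (hirr j) (fun h => ?_) l w m u
        apply hst
        rw [← hi, ← hj, hdist i j h]
  have hdisj : ∀ f, f ∈ A 0 → f ∈ A 1 → f = 0 := by
    intro f h0 h1
    funext x
    obtain ⟨a, ha, b, hb, hab⟩ := Submodule.mem_sup.mp (htop (Pi.single x⁻¹ 1))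
    have : B f (Pi.single x⁻¹ 1) = 0 := by
      rw [← hab, map_add, horth 1 0 (by decide) f h1 a ha, horth 0 1 (by decide) f h0 b hb,
        add_zero]
    rw [hB] at this
    simpa [Pi.single_apply] using this
  have hmul : ∀ s t, s ≠ t → ∀ f ∈ A s, ∀ m v, (coef ρ m v) * f ∈ A t := by
    intro s t hst f hf m v
    induction hf using Submodule.span_induction with
    | zero => simp
    | add x y _ _ hx hy => rw [mul_add]; exact (A t).add_mem hx hy
    | smul c x _ hx => rw [mul_smul_comm]; exact (A t).smul_mem c hx
    | mem x hx =>
      obtain ⟨i, l, w, hi, rfl⟩ := hx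
      have := coef_mem W Irr hirr hcompl _ _ ((Irr i).tprod ρ) rfl (A t) (by
        intro j hj l' w'
        have h1 := hε i j ((multHom_ne_zero_iff _ _).mpr hj)
        refine Submodule.subset_span ⟨j, l', w', ?_, rfl⟩
        rw [hi] at h1
        exact zmod2_aux s t _ hst h1)
        (LinearMap.mul' ℂ ℂ ∘ₗ TensorProduct.map l m) (w ⊗ₜ v)
      convert this using 1
      funext g
      simp [coef, mul_comm]
  obtain ⟨a, ha, b, hb, hab⟩ := Submodule.mem_sup.mp (htop (Pi.single 1 1))
  have hne : a - b ≠ 0 := by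
    intro h
    have h' : a = b := sub_eq_zero.mp h
    have ha0 : a = 0 := hdisj a ha (h' ▸ hb)
    have := congrFun hab 1
    rw [← h', ha0] at this
    simp at this
  obtain ⟨h, hh⟩ := Function.ne_iff.mp hne
  refine ⟨h, fun v => ?_⟩
  have hm : ∀ m : V →ₗ[ℂ] ℂ, m (ρ h v + v) = 0 := by
    intro m
    set c := coef ρ m v with hc
    have hd : c * (a + b) = c 1 • (a + b) := by
      rw [hab]
      funext x
      by_cases hx : x = 1
      · subst hx; simp
      · simp [hx]
    have e : c * a - c 1 • b = c 1 • a - c * b := by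
      rw [mul_add, smul_add] at hd
      rw [sub_eq_sub_iff_add_eq_add, hd]
    have z1 : c * a - c 1 • b = 0 := by
      refine hdisj _ ?_ ?_
      · rw [e]
        exact (A 0).sub_mem ((A 0).smul_mem _ ha) (hmul 1 0 (by decide) b hb m v)
      · exact (A 1).sub_mem (hmul 0 1 (by decide) a ha m v) ((A 1).smul_mem _ hb)
    have z2 := e.symm.trans z1
    have w1 := congrFun z1 h
    have w2 := congrFun z2 h
    simp only [Pi.sub_apply, Pi.mul_apply, Pi.smul_apply, smul_eq_mul, Pi.zero_apply] at w1 w2 hh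
    have : (c h + c 1) * (a h - b h) = 0 := by linear_combination w1 + w2
    rcases mul_eq_zero.mp this with h3 | h3
    · simpa [hc, coef] using h3
    · exact absurd h3 hh
  exact eq_neg_of_add_eq_zero_left ((Module.forall_dual_apply_eq_zero_iff ℂ _).mp hm)

end aux

/-- For an irreducible, faithful, self-dual representation `ρ` of a finite
group `G`, the McKay graph `Γ(G,ρ)` is bipartite if and only if the center of `G` has exactly
2 elements. -/
theorem mckay_bipartite_iff_center_card_two
    {G : Type} [Group G] [Fintype G]
    {V : Type} [AddCommGroup V] [Module ℂ V] [FiniteDimensional ℂ V]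
    (ρ : Representation ℂ G V)
    (hρ : IsIrreducibleRep ρ) (hfaith : Function.Injective ⇑ρ)
    (hsd : RepIso ρ ρ.dual)
    {ι : Type} [Fintype ι]
    (W : ι → Type) [∀ i, AddCommGroup (W i)] [∀ i, Module ℂ (W i)]
    [∀ i, FiniteDimensional ℂ (W i)]
    (Irr : (i : ι) → Representation ℂ G (W i))
    (hirr : ∀ i, IsIrreducibleRep (Irr i))
    (hdist : ∀ i j, RepIso (Irr i) (Irr j) → i = j)
    (hcompl : ∀ (U : Type) [AddCommGroup U] [Module ℂ U] [FiniteDimensional ℂ U]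
      (σ : Representation ℂ G U), IsIrreducibleRep σ → ∃ i, RepIso σ (Irr i)) :
    (∃ ε : ι → ZMod 2, ∀ i j, multHom ((Irr i).tprod ρ) (Irr j) ≠ 0 → ε j ≠ ε i) ↔
      Nat.card (Subgroup.center G) = 2 := by
  classical
  have := hρ.1
  obtain ⟨v₀, hv₀⟩ := exists_ne (0 : V)
  constructor
  · rintro ⟨ε, hε⟩
    obtain ⟨h, hh⟩ := exists_neg_one ρ W Irr hirr hdist hcompl ε hε
    have hcen : h ∈ Subgroup.center G := by
      rw [Subgroup.mem_center_iff]
      intro g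
      apply hfaith
      ext v
      simp [hh]
    have h1 : h ≠ 1 := by
      rintro rfl
      have := hh v₀
      rw [map_one, Module.End.one_apply] at this
      exact hv₀ (eq_zero_of_eq_neg this)
    rw [Nat.card_eq_two_iff]
    refine ⟨1, ⟨h, hcen⟩, fun e => h1 (congrArg Subtype.val e).symm, ?_⟩
    rw [Set.eq_univ_iff_forall]
    rintro ⟨z, hz⟩
    obtain ⟨c, hc⟩ := central_scalar ρ hρ z hz
    obtain ⟨e, he⟩ := hsd
    have hcc : c * c = 1 := by
      -- e (z v) = e v ∘ z⁻¹
      have h2 : ∀ x, c * (c * e v₀ x) = e v₀ x := by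
        intro x
        have h3 := LinearMap.congr_fun (he z v₀) (ρ z x)
        rw [hc v₀, map_smul, Representation.dual_apply, Module.Dual.transpose_apply] at h3
        rw [LinearMap.smul_apply, LinearMap.comp_apply, smul_eq_mul,
          Representation.inv_self_apply, hc x, map_smul, smul_eq_mul] at h3
        exact h3
      have hne : e v₀ ≠ 0 := fun h => hv₀ (e.injective (h.trans (map_zero e).symm))
      obtain ⟨x, hx⟩ := DFunLike.ne_iff.mp hne
      have h5 : (c * c) * e v₀ x = 1 * e v₀ x := by rw [mul_assoc, h2, one_mul]
      exact mul_right_cancel₀ hx h5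
    have : c = 1 ∨ c = -1 := mul_self_eq_one_iff.mp hcc
    rcases this with rfl | rfl
    · left
      apply Subtype.ext
      apply hfaith
      ext v
      simp [hc]
    · right
      apply Subtype.ext
      apply hfaith
      ext v
      simp [hc, hh]
  · intro hcard
    obtain ⟨a, b, hab, huniv⟩ := Nat.card_eq_two_iff.mp hcard
    have hex : ∃ z ∈ Subgroup.center G, z ≠ 1 := by
      by_cases ha : a = 1
      · exact ⟨b, b.2, fun h => hab (ha.trans (Subtype.ext h.symm))⟩
      · exact ⟨a, a.2, fun h => ha (Subtype.ext h)⟩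
    obtain ⟨z, hz, hz1⟩ := hex
    have hzz : z * z = 1 := by
      have : (⟨z, hz⟩ : Subgroup.center G) ^ 2 = 1 := by
        rw [← hcard]; exact pow_card_eq_one'
      simpa [pow_two] using congrArg Subtype.val this
    have hsc : ∀ {U : Type} [AddCommGroup U] [Module ℂ U] [FiniteDimensional ℂ U]
        (π : Representation ℂ G U), IsIrreducibleRep π →
        (∀ v, π z v = v) ∨ (∀ v, π z v = -v) := by
      intro U _ _ _ π hπ
      obtain ⟨c, hc⟩ := central_scalar π hπ z hz
      have := hπ.1
      obtain ⟨u, hu⟩ := exists_ne (0 : U)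
      have h2 : (c * c) • u = (1 : ℂ) • u := by
        rw [mul_smul, ← hc u, ← map_smul, ← hc u, ← Module.End.mul_apply, ← map_mul, hzz]
        simp
      have h3 : c * c = 1 := smul_left_injective ℂ hu h2
      rcases mul_self_eq_one_iff.mp h3 with rfl | rfl
      · left; intro v; simp [hc]
      · right; intro v; simp [hc]
    have hρz : ∀ v, ρ z v = -v := by
      rcases hsc ρ hρ with h | h
      · exfalso
        apply hz1
        apply hfaith
        ext v
        simp [h]
      · exact h
    refine ⟨fun i => if ∀ v, Irr i z v = v then 0 else 1, fun i j hm => ?_⟩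
    obtain ⟨T, hT, hT0⟩ := (multHom_ne_zero_iff _ _).mp hm
    have hex : ∃ w v, T (w ⊗ₜ v) ≠ 0 := by
      by_contra hcon
      push Not at hcon
      exact hT0 (TensorProduct.ext' fun w v => by simpa using hcon w v)
    obtain ⟨w, v, hwv⟩ := hex
    have hTz := hT z (w ⊗ₜ v)
    rw [Representation.tprod_apply, TensorProduct.map_tmul, hρz] at hTz
    have hnt : ∀ k, (∀ x, Irr k z x = -x) → ¬ ∀ x, Irr k z x = x := by
      intro k h h'
      have := (hirr k).1
      obtain ⟨u, hu⟩ := exists_ne (0 : W k)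
      exact hu (eq_zero_of_eq_neg ((h' u).symm.trans (h u)))
    rcases hsc (Irr i) (hirr i) with hi | hi <;> rcases hsc (Irr j) (hirr j) with hj | hj
    · rw [hi, hj, TensorProduct.tmul_neg, map_neg] at hTz
      exact absurd (eq_zero_of_eq_neg hTz.symm) hwv
    · simp only [if_pos hi, if_neg (hnt j hj)]; decide
    · simp only [if_pos hj, if_neg (hnt i hi)]; decide
    · rw [hi, hj, TensorProduct.neg_tmul, TensorProduct.tmul_neg, neg_neg] at hTz
      exact absurd (eq_zero_of_eq_neg hTz) hwv
end

section
/- Let G be a finite group and ρ a nonzero finite-dimensional complex representation of G such that the McKay graph Γ(G,ρ) is a tree (for all μ,λ ∈ Irr(G), [μ⊗ρ:λ] = [λ⊗ρ:μ] ≤ 1 and [μ⊗ρ:μ] = 0, and the simple graph on Irr(G) with μ adjacent to λ iff [μ⊗ρ:λ] = 1 is connected and acyclic). Then the center Z(G) has exactly 2 elements, and for every g ∈ G with g ∉ Z(G), dim_ℂ End_{C(g)}(ρ↓_{C(g)}) = 2, where C(g) is the centralizer of g in G. -/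
open scoped TensorProduct

section McKay
open Representation

lemma mk_multHom {G V W : Type} [Group G] [Fintype G]
    [AddCommGroup V] [Module ℂ V] [FiniteDimensional ℂ V]
    [AddCommGroup W] [Module ℂ W] [FiniteDimensional ℂ W]
    (π : Representation ℂ G V) (τ : Representation ℂ G W) :
    (multHom π τ : ℂ) = (Nat.card G : ℂ)⁻¹ * ∑ g : G, π.character g⁻¹ * τ.character g := by
  haveI : Invertible (Nat.card G : ℂ) := invertibleOfNonzero (by simp)
  rw [multHom, ← card_inv_mul_sum_char_eq_finrank]
  simp

lemma mk_irr {G V : Type} [Group G] [AddCommGroup V] [Module ℂ V]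
    {ρ : Representation ℂ G V} (h : IsIrreducibleRep ρ) : IsIrreducible ρ := by
  obtain ⟨hn, h⟩ := h
  haveI := hn
  refine { exists_pair_ne := ⟨⊥, ⊤, fun he => ?_⟩, eq_bot_or_eq_top := fun p => ?_ }
  · have := congrArg Subrepresentation.toSubmodule he
    exact bot_ne_top this
  · rcases h p.toSubmodule (fun g v hv => p.apply_mem_toSubmodule g hv) with h | h
    · left; exact Subrepresentation.toSubmodule_injective h
    · right; exact Subrepresentation.toSubmodule_injective h

lemma mk_char_iso {G V W : Type} [Group G] [AddCommGroup V] [Module ℂ V]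
    [AddCommGroup W] [Module ℂ W] 
    {π : Representation ℂ G V} {τ : Representation ℂ G W} (h : RepIso π τ) :
    π.character = τ.character := by
  obtain ⟨e, he⟩ := h
  exact char_iso (Representation.Equiv.mk e (fun g => by ext v; simp [he]))

lemma mk_split {G V : Type} [Group G] [Fintype G] [AddCommGroup V] [Module ℂ V]
    [FiniteDimensional ℂ V]
    (π : Representation ℂ G V) (p q : Subrepresentation π) (h : IsCompl p q) :
    π.character = p.toRepresentation.character + q.toRepresentation.character := by
  have h' : IsCompl p.toSubmodule q.toSubmodule := by
    constructor
    · rw [disjoint_iff, ← Subrepresentation.toSubmodule_inf, h.inf_eq_bot]; rfl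
    · rw [codisjoint_iff, ← Subrepresentation.toSubmodule_sup, h.sup_eq_top]; rfl
  let e := Submodule.prodEquivOfIsCompl _ _ h'
  have := char_iso (ρ := p.toRepresentation.prod q.toRepresentation) (σ := π)
    (Representation.Equiv.mk e (fun g => by
      ext v <;> simp [e, Representation.prod] <;> rfl))
  rw [← this]
  ext g
  simp only [character, Representation.prod, Pi.add_apply]
  exact LinearMap.trace_prodMap' _ _

section
variable {G : Type} [Group G] [Fintype G]
    {ι : Type} [Fintype ι]
    (W : ι → Type) [∀ i, AddCommGroup (W i)] [∀ i, Module ℂ (W i)]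
    [∀ i, FiniteDimensional ℂ (W i)]
    (Irr : (i : ι) → Representation ℂ G (W i))
    (hirr : ∀ i, IsIrreducibleRep (Irr i))
    (hdist : ∀ i j, RepIso (Irr i) (Irr j) → i = j)
    (hcompl : ∀ (U : Type) [AddCommGroup U] [Module ℂ U] [FiniteDimensional ℂ U]
      (σ : Representation ℂ G U), IsIrreducibleRep σ → ∃ i, RepIso σ (Irr i))

include hirr hdist in
open Classical in
lemma mk_orth (i j : ι) : multHom (Irr i) (Irr j) = if i = j then 1 else 0 := by
  haveI : Invertible (Nat.card G : ℂ) := invertibleOfNonzero (by simp)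
  haveI := fun i => mk_irr (hirr i)
  have h := char_orthonormal (Irr j) (Irr i)
  have h2 := mk_multHom (Irr i) (Irr j)
  have : Nonempty ((Irr i).Equiv (Irr j)) ↔ i = j := by
    constructor
    · rintro ⟨e⟩
      exact hdist i j ⟨e.toLinearEquiv, fun g v => IntertwiningMap.isIntertwining _ _ e.toIntertwiningMap g v⟩
    · rintro rfl
      exact ⟨.refl _⟩
  simp only [this] at h
  have h3 : (multHom (Irr i) (Irr j) : ℂ) = if i = j then 1 else 0 := by
    rw [h2, ← h]; simp_rw [mul_comm]
  exact_mod_cast h3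

include hirr hdist hcompl in
lemma mk_decomp (n : ℕ) : ∀ (U : Type) [AddCommGroup U] [Module ℂ U] [FiniteDimensional ℂ U]
      (σ : Representation ℂ G U), Module.finrank ℂ U = n → ∀ g, 
      σ.character g = ∑ i, (multHom σ (Irr i) : ℂ) * (Irr i).character g := by
  classical
  induction n using Nat.strong_induction_on with
  | _ n ih =>
  intro U _ _ _ σ hn g
  by_cases hs : IsIrreducibleRep σ
  · obtain ⟨i, hi⟩ := hcompl U σ hs
    have hc := mk_char_iso hi
    have : ∀ j, multHom σ (Irr j) = if i = j then 1 else 0 := by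
      intro j
      rw [← mk_orth W Irr hirr hdist]
      have : (multHom σ (Irr j) : ℂ) = multHom (Irr i) (Irr j) := by
        rw [mk_multHom, mk_multHom, hc]
      exact_mod_cast this
    simp [this, hc]
  · by_cases hN : Nontrivial U
    · have : ∃ p : Submodule ℂ U, (∀ g : G, ∀ v ∈ p, σ g v ∈ p) ∧ p ≠ ⊥ ∧ p ≠ ⊤ := by
        by_contra! hcon
        exact hs ⟨hN, fun p hp => or_iff_not_imp_left.2 (hcon p hp)⟩
      obtain ⟨p, hp, hb, ht⟩ := this
      let P : Subrepresentation σ := ⟨p, fun g v hv => hp g v hv⟩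
      haveI : NeZero (Nat.card G : ℂ) := ⟨by simp⟩
      obtain ⟨Q, hQ⟩ := exists_isCompl P
      have hsp := mk_split σ P Q hQ
      have hP : Module.finrank ℂ P.toSubmodule < n := by
        rw [← hn]; exact Submodule.finrank_lt ht
      have hd : Module.finrank ℂ P.toSubmodule + Module.finrank ℂ Q.toSubmodule = n := by
        have := congrFun hsp 1
        simp only [char_one, Pi.add_apply, hn] at this
        exact_mod_cast this.symm
      have hP0 : 0 < Module.finrank ℂ P.toSubmodule := by
        rw [Nat.pos_iff_ne_zero]
        intro h0
        exact hb (Submodule.finrank_eq_zero.1 h0)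
      have e1 := ih _ hP _ P.toRepresentation rfl g
      have e2 := ih _ (by omega) _ Q.toRepresentation rfl g
      have hm : ∀ i, (multHom σ (Irr i) : ℂ) = multHom P.toRepresentation (Irr i)
          + multHom Q.toRepresentation (Irr i) := by
        intro i
        simp only [mk_multHom, hsp, Pi.add_apply, add_mul, Finset.sum_add_distrib, mul_add]
      simp only [hm, add_mul, Finset.sum_add_distrib, ← e1, ← e2, hsp, Pi.add_apply]
    · rw [not_nontrivial_iff_subsingleton] at hN
      have h0 : ∀ g, σ.character g = 0 := fun g => by
        rw [character, Subsingleton.elim (σ g) 0, map_zero]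
      simp [mk_multHom, h0]

open Classical in
lemma mk_trace_perm (s : G → G) :
    LinearMap.trace ℂ (G → ℂ) (LinearMap.funLeft ℂ ℂ s) =
      ((Finset.univ.filter (fun x => s x = x)).card : ℂ) := by
  rw [LinearMap.trace_eq_matrix_trace ℂ (Pi.basisFun ℂ G), Matrix.trace]
  simp only [Matrix.diag_apply, LinearMap.toMatrix_apply, Pi.basisFun_apply, Pi.basisFun_repr,
    LinearMap.funLeft_apply, Pi.single_apply]
  simp

/-- The regular representation on functions. -/
noncomputable def mkReg (G : Type) [Group G] : Representation ℂ G (G → ℂ) where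
  toFun g := LinearMap.funLeft ℂ ℂ (fun x => g⁻¹ * x)
  map_one' := by ext; simp [LinearMap.funLeft]
  map_mul' g h := by ext; simp [LinearMap.funLeft, mul_assoc]

open Classical in
lemma mk_reg_char (g : G) : (mkReg G).character g = if g = 1 then (Fintype.card G : ℂ) else 0 := by
  have : (mkReg G).character g = LinearMap.trace ℂ (G → ℂ)
    (LinearMap.funLeft ℂ ℂ (fun x => g⁻¹ * x)) := rfl
  rw [this, mk_trace_perm]
  by_cases h : g = 1 <;> simp [h]

include hirr hdist hcompl in
open Classical in
lemma mk_delta (g : G) : ∑ i, (Module.finrank ℂ (W i) : ℂ) * (Irr i).character g =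
    if g = 1 then (Fintype.card G : ℂ) else 0 := by
  rw [← mk_reg_char, mk_decomp W Irr hirr hdist hcompl _ _ (mkReg G) rfl]
  refine Finset.sum_congr rfl fun i _ => ?_
  congr 1
  rw [mk_multHom]
  simp [mk_reg_char]

/-- Fourier transform component. -/
noncomputable def mkPhi (i : ι) : (G → ℂ) →ₗ[ℂ] Module.End ℂ (W i) :=
  ∑ g : G, (LinearMap.proj g : (G → ℂ) →ₗ[ℂ] ℂ).smulRight (Irr i g)

/-- Inverse Fourier transform component. -/
noncomputable def mkPsi (i : ι) : Module.End ℂ (W i) →ₗ[ℂ] (G → ℂ) :=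
  LinearMap.pi fun h => ((Fintype.card G : ℂ)⁻¹ * (Module.finrank ℂ (W i) : ℂ)) •
    (LinearMap.trace ℂ (W i) ∘ₗ LinearMap.mulRight ℂ (Irr i h⁻¹))

lemma mkPhi_apply (i : ι) (a : G → ℂ) : mkPhi W Irr i a = ∑ g, a g • Irr i g := by
  simp [mkPhi]

lemma mkPsi_apply (i : ι) (T) (h : G) : mkPsi W Irr i T h =
  (Fintype.card G : ℂ)⁻¹ * (Module.finrank ℂ (W i) : ℂ) *
    LinearMap.trace ℂ (W i) (T * Irr i h⁻¹) := by
  simp [mkPsi]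

include hirr hdist hcompl in
lemma mk_psi_phi (a : G → ℂ) : ∑ i, mkPsi W Irr i (mkPhi W Irr i a) = a := by
  classical
  ext h
  have h1 : ∀ i, mkPsi W Irr i (mkPhi W Irr i a) h = ∑ g, (Fintype.card G : ℂ)⁻¹ * a g *
     ((Module.finrank ℂ (W i) : ℂ) * (Irr i).character (g * h⁻¹)) := by
    intro i
    rw [mkPsi_apply, mkPhi_apply, Finset.sum_mul, map_sum, Finset.mul_sum]
    refine Finset.sum_congr rfl fun g _ => ?_
    rw [smul_mul_assoc, map_smul, character, map_mul (Irr i), smul_eq_mul]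
    ring
  rw [Finset.sum_apply]
  simp_rw [h1]
  rw [Finset.sum_comm]
  simp_rw [← Finset.mul_sum, mk_delta W Irr hirr hdist hcompl, mul_inv_eq_one]
  simp
  field_simp

include hirr hdist hcompl in
lemma mk_phi_psi (i : ι) (T : Module.End ℂ (W i)) : mkPhi W Irr i (mkPsi W Irr i T) = T := by
  classical
  let F : (G → ℂ) →ₗ[ℂ] ((i : ι) → Module.End ℂ (W i)) := LinearMap.pi (fun i => mkPhi W Irr i)
  let K : ((i : ι) → Module.End ℂ (W i)) →ₗ[ℂ] (G → ℂ) :=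
    ∑ i, mkPsi W Irr i ∘ₗ LinearMap.proj i
  have hKF : ∀ a, K (F a) = a := fun a => by
    simp only [K, F, LinearMap.sum_apply, LinearMap.comp_apply, LinearMap.proj_apply,
      LinearMap.pi_apply]
    exact mk_psi_phi W Irr hirr hdist hcompl a
  have hinj : Function.Injective F := Function.LeftInverse.injective hKF
  have hdim : Module.finrank ℂ (G → ℂ) = Module.finrank ℂ ((i : ι) → Module.End ℂ (W i)) := by
    have := mk_delta W Irr hirr hdist hcompl 1
    simp only [char_one, if_true] at this
    rw [Module.finrank_fintype_fun_eq_card, Module.finrank_pi_fintype]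
    simp only [Module.End, Module.finrank_linearMap]
    exact_mod_cast this.symm
  have hsurj : Function.Surjective F :=
    (LinearMap.injective_iff_surjective_of_finrank_eq_finrank hdim).1 hinj
  have hFK : ∀ t, F (K t) = t := fun t => by
    obtain ⟨a, rfl⟩ := hsurj t
    rw [hKF]
  have := congrFun (hFK (Pi.single i T)) i
  have hK : K (Pi.single i T) = mkPsi W Irr i T := by
    simp only [K, LinearMap.sum_apply, LinearMap.comp_apply, LinearMap.proj_apply]
    rw [Finset.sum_eq_single i]
    · simp
    · intro j _ hj
      rw [Pi.single_eq_of_ne hj, map_zero]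
    · simp
  rw [hK, Pi.single_eq_same] at this
  exact this

include hirr hdist hcompl in
lemma mk_col (g : G) : ∑ i, (Irr i).character g⁻¹ * (Irr i).character g =
    (Nat.card (Subgroup.centralizer {g}) : ℂ) := by
  classical
  let c : (G → ℂ) →ₗ[ℂ] (G → ℂ) := LinearMap.funLeft ℂ ℂ (fun x => g⁻¹ * x * g)
  have h1 : LinearMap.trace ℂ _ c = (Nat.card (Subgroup.centralizer {g}) : ℂ) := by
    rw [mk_trace_perm, Nat.card_eq_fintype_card, Fintype.card_subtype]
    congr 2
    ext x
    simp only [Finset.mem_filter, Finset.mem_univ, true_and, Subgroup.mem_centralizer_singleton_iff]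
    rw [mul_assoc, inv_mul_eq_iff_eq_mul]
  have h2 : c = ∑ i, (c ∘ₗ mkPsi W Irr i) ∘ₗ mkPhi W Irr i := by
    refine LinearMap.ext fun a => ?_
    conv_lhs => rw [← mk_psi_phi W Irr hirr hdist hcompl a]
    simp
  have h3 : ∀ i, mkPhi W Irr i ∘ₗ c = linHom (Irr i) (Irr i) g ∘ₗ mkPhi W Irr i := by
    intro i
    refine LinearMap.ext fun a => ?_
    simp only [LinearMap.comp_apply, mkPhi_apply, linHom_apply, c, LinearMap.funLeft_apply]
    simp only [← Module.End.mul_eq_comp]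
    rw [Finset.sum_mul, Finset.mul_sum]
    refine Fintype.sum_equiv ((MulAut.conj g⁻¹).toEquiv) _ _ fun x => ?_
    rw [smul_mul_assoc, mul_smul_comm, ← map_mul, ← map_mul]
    simp [mul_assoc]
  rw [← h1, h2, map_sum]
  refine Finset.sum_congr rfl fun i _ => ?_
  rw [LinearMap.trace_comp_comm', ← LinearMap.comp_assoc, h3, LinearMap.comp_assoc,
    ← char_linHom, character]
  congr 1
  refine LinearMap.ext fun T => ?_
  simp [mk_phi_psi W Irr hirr hdist hcompl]


include hirr hdist hcompl in
lemma mk_sq {U : Type} [AddCommGroup U] [Module ℂ U] [FiniteDimensional ℂ U]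
    (σ : Representation ℂ G U) : multHom σ σ = ∑ j, multHom σ (Irr j) ^ 2 := by
  have : (multHom σ σ : ℂ) = ∑ j, (multHom σ (Irr j) : ℂ) ^ 2 := by
    rw [mk_multHom]
    have h : ∀ g, σ.character g⁻¹ * σ.character g =
        ∑ j, (multHom σ (Irr j) : ℂ) * (σ.character g⁻¹ * (Irr j).character g) := by
      intro g
      rw [mk_decomp W Irr hirr hdist hcompl _ _ σ rfl g, Finset.mul_sum]
      exact Finset.sum_congr rfl fun j _ => by ring
    simp_rw [h]
    rw [Finset.sum_comm, Finset.mul_sum]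
    refine Finset.sum_congr rfl fun j _ => ?_
    rw [← Finset.mul_sum, sq, mul_left_comm, ← mk_multHom]
  exact_mod_cast this

lemma mk_cardmul {U : Type} [AddCommGroup U] [Module ℂ U] [FiniteDimensional ℂ U]
    (σ : Representation ℂ G U) : (Nat.card G : ℂ) * multHom σ σ =
      ∑ g, σ.character g⁻¹ * σ.character g := by
  rw [mk_multHom, mul_inv_cancel_left₀]
  simp

include hirr hdist hcompl in
lemma mk_count2 : ∑ g : G, Nat.card (Subgroup.centralizer {g}) = Nat.card G * Fintype.card ι := by
  classical
  have : ∑ g : G, (Nat.card (Subgroup.centralizer {g}) : ℂ) = Nat.card G * Fintype.card ι := by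
    simp_rw [← mk_col W Irr hirr hdist hcompl]
    rw [Finset.sum_comm]
    simp_rw [← mk_cardmul, mk_orth W Irr hirr hdist]
    simp [mul_comm]
  exact_mod_cast this

include hirr hdist hcompl in
lemma mk_count1 {V : Type} [AddCommGroup V] [Module ℂ V] [FiniteDimensional ℂ V]
    (ρ : Representation ℂ G V) :
    ∑ g : G, Nat.card (Subgroup.centralizer {g}) *
      multHom (ρ.comp (Subgroup.centralizer {g}).subtype)
          (ρ.comp (Subgroup.centralizer {g}).subtype) =
    Nat.card G * ∑ i, ∑ j, multHom ((Irr i).tprod ρ) (Irr j) ^ 2 := by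
  classical
  simp_rw [← mk_sq W Irr hirr hdist hcompl]
  have h1 : ∀ g : G, (Nat.card (Subgroup.centralizer {g}) : ℂ) *
      multHom (ρ.comp (Subgroup.centralizer {g}).subtype)
          (ρ.comp (Subgroup.centralizer {g}).subtype) =
      ∑ h : G, if h * g = g * h then ρ.character h⁻¹ * ρ.character h else 0 := by
    intro g
    rw [mk_cardmul, ← Finset.sum_filter]
    symm
    refine Finset.sum_subtype (p := fun x => x ∈ Subgroup.centralizer {g}) _ ?_
      (fun h => ρ.character h⁻¹ * ρ.character h)
    intro x
    simp [Subgroup.mem_centralizer_singleton_iff]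
  have : ∑ g : G, (Nat.card (Subgroup.centralizer {g}) : ℂ) *
      multHom (ρ.comp (Subgroup.centralizer {g}).subtype)
          (ρ.comp (Subgroup.centralizer {g}).subtype) =
    Nat.card G * ∑ i, (multHom ((Irr i).tprod ρ) ((Irr i).tprod ρ) : ℂ) := by
    simp_rw [h1]
    rw [Finset.sum_comm, Finset.mul_sum]
    have hc : ∀ i, (Nat.card G : ℂ) * (multHom ((Irr i).tprod ρ) ((Irr i).tprod ρ) : ℂ) = _ :=
      fun i => mk_cardmul ((Irr i).tprod ρ)
    simp_rw [hc]
    rw [Finset.sum_comm (s := (Finset.univ : Finset ι))]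
    refine Finset.sum_congr rfl fun h _ => ?_
    have : ∀ i, ((Irr i).tprod ρ).character h⁻¹ * ((Irr i).tprod ρ).character h =
      ((Irr i).character h⁻¹ * (Irr i).character h) * (ρ.character h⁻¹ * ρ.character h) := by
      intro i
      rw [char_tensor]
      simp only [Pi.mul_apply]
      ring
    simp_rw [this]
    rw [← Finset.sum_mul, mk_col W Irr hirr hdist hcompl, ← Finset.sum_filter, Finset.sum_const,
      nsmul_eq_mul, Nat.card_eq_fintype_card, Fintype.card_subtype]
    congr 3
    ext x
    simp [Subgroup.mem_centralizer_singleton_iff, eq_comm]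
  exact_mod_cast this

lemma mk_edges (m : ι → ι → ℕ) (hsym : ∀ i j, m i j = m j i)
    (hle : ∀ i j, m i j ≤ 1)
    (hloop : ∀ i, m i i = 0)
    (htree : (SimpleGraph.fromRel fun i j => m i j = 1).IsTree) :
    ∑ i, ∑ j, m i j ^ 2 + 2 = 2 * Fintype.card ι := by
  classical
  have h1 := htree.card_edgeFinset
  have h2 := SimpleGraph.sum_degrees_eq_twice_card_edges (SimpleGraph.fromRel fun i j => m i j = 1)
  have h3 : ∀ i, ∑ j, m i j ^ 2 = (SimpleGraph.fromRel fun i j => m i j = 1).degree i := by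
    intro i
    rw [← SimpleGraph.card_neighborFinset_eq_degree, SimpleGraph.neighborFinset_eq_filter,
      Finset.card_filter]
    refine Finset.sum_congr rfl fun j _ => ?_
    simp only [SimpleGraph.fromRel_adj]
    have a := hsym i j
    have b := hle i j
    have c := hloop i
    by_cases hij : i = j
    · subst hij; simp [c]
    · rw [← a]
      interval_cases m i j <;> simp [hij]
  simp_rw [h3]
  omega

lemma mk_hom {G V W : Type} [Group G]
    [AddCommGroup V] [Module ℂ V] 
    [AddCommGroup W] [Module ℂ W]
    (π : Representation ℂ G V) (τ : Representation ℂ G W) (hτ : IsIrreducibleRep τ)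
    (h : multHom π τ = 1) : ∃ f : V →ₗ[ℂ] W, f ≠ 0 ∧ Function.Surjective f ∧
      ∀ g v, f (π g v) = τ g (f v) := by
  have : Nontrivial (linHom π τ).invariants := by
    apply Module.nontrivial_of_finrank_pos (R := ℂ)
    rw [multHom] at h; omega
  obtain ⟨f, hf⟩ := exists_ne (0 : (linHom π τ).invariants)
  have he : ∀ g v, f.1 (π g v) = τ g (f.1 v) := by
    intro g v
    have := LinearMap.congr_fun (f.2 g) (π g v)
    rw [linHom_apply] at this
    simp only [LinearMap.comp_apply, inv_self_apply] at this
    exact this.symm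
  have hf0 : f.1 ≠ 0 := fun h => hf (Subtype.ext h)
  refine ⟨f.1, hf0, ?_, he⟩
  rw [← LinearMap.range_eq_top]
  refine (hτ.2 (LinearMap.range f.1) ?_).resolve_left ?_
  · rintro g _ ⟨v, rfl⟩
    exact ⟨π g v, he g v⟩
  · rwa [LinearMap.range_eq_bot]

include hcompl in
lemma mk_triv : ∃ i₀, Module.finrank ℂ (W i₀) = 1 ∧ ∀ g, Irr i₀ g = 1 := by
  obtain ⟨i, e, he⟩ := hcompl ℂ (Representation.trivial ℂ G ℂ) ⟨inferInstance, fun p _ => eq_bot_or_eq_top p⟩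
  refine ⟨i, by rw [← e.finrank_eq]; simp, fun g => ?_⟩
  refine LinearMap.ext fun w => ?_
  have := he g (e.symm w)
  simpa using this.symm

include hirr hdist hcompl in
lemma mk_faithful {V : Type} [AddCommGroup V] [Module ℂ V] [FiniteDimensional ℂ V]
    (ρ : Representation ℂ G V)
    (hsym : ∀ i j, multHom ((Irr i).tprod ρ) (Irr j) = multHom ((Irr j).tprod ρ) (Irr i))
    (htree : (SimpleGraph.fromRel fun i j => multHom ((Irr i).tprod ρ) (Irr j) = 1).IsTree)
    (x : G) (hx : ρ x = 1) : x = 1 := by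
  classical
  obtain ⟨i₀, -, hi₀⟩ := mk_triv W Irr hcompl
  have step : ∀ i j, (SimpleGraph.fromRel fun i j => multHom ((Irr i).tprod ρ) (Irr j) = 1).Adj i j →
      Irr i x = 1 → Irr j x = 1 := by
    intro i j hadj hi
    rw [SimpleGraph.fromRel_adj, hsym j i, or_self] at hadj
    obtain ⟨f, -, hs, hf⟩ := mk_hom _ _ (hirr j) hadj.2
    refine LinearMap.ext fun w => ?_
    obtain ⟨v, rfl⟩ := hs w
    rw [← hf, Representation.tprod_apply, hi, hx]
    simp [Module.End.one_eq_id]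
  have all : ∀ j, Irr j x = 1 := by
    intro j
    obtain ⟨p⟩ := htree.connected.preconnected i₀ j
    have : ∀ (a b) (p : (SimpleGraph.fromRel fun i j => multHom ((Irr i).tprod ρ) (Irr j) = 1).Walk a b),
        Irr a x = 1 → Irr b x = 1 := by
      intro a b p
      induction p with
      | nil => exact id
      | cons h p ih => exact fun ha => ih (step _ _ h ha)
    exact this _ _ p (hi₀ x)
  by_contra hne
  have h1 := mk_delta W Irr hirr hdist hcompl x
  have h2 := mk_delta W Irr hirr hdist hcompl 1
  rw [if_neg hne] at h1
  rw [if_pos rfl] at h2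
  have : (Fintype.card G : ℂ) = 0 := by
    rw [← h1, ← h2]
    refine Finset.sum_congr rfl fun i _ => ?_
    rw [character, character, all, map_one]
  simp at this


lemma mk_one_le {H V : Type} [Group H] [AddCommGroup V] [Module ℂ V] [FiniteDimensional ℂ V]
    (hV : Module.finrank ℂ V ≠ 0) (σ : Representation ℂ H V) : 1 ≤ multHom σ σ := by
  have : Nontrivial V := Module.nontrivial_of_finrank_pos (R := ℂ) (Nat.pos_of_ne_zero hV)
  have hid : (1 : Module.End ℂ V) ∈ (linHom σ σ).invariants := by
    intro h
    rw [linHom_apply, Module.End.one_eq_id, LinearMap.id_comp, ← Module.End.mul_eq_comp, ← map_mul]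
    simp [Module.End.one_eq_id]
  rw [multHom]
  have : Nontrivial (linHom σ σ).invariants :=
    ⟨⟨⟨1, hid⟩, 0, fun h => one_ne_zero (congrArg Subtype.val h)⟩⟩
  exact Module.finrank_pos

lemma mk_two_le {H V : Type} [Group H] [AddCommGroup V] [Module ℂ V] [FiniteDimensional ℂ V]
    (hV : Module.finrank ℂ V ≠ 0) (σ : Representation ℂ H V) (T : Module.End ℂ V)
    (hT : ∀ h, σ h * T = T * σ h) (hs : ∀ c : ℂ, T ≠ c • 1) : 2 ≤ multHom σ σ := by
  have : Nontrivial V := Module.nontrivial_of_finrank_pos (R := ℂ) (Nat.pos_of_ne_zero hV)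
  have key : ∀ T : Module.End ℂ V, (∀ h, σ h * T = T * σ h) → T ∈ (linHom σ σ).invariants := by
    intro T hT h
    rw [linHom_apply, ← LinearMap.comp_assoc, ← Module.End.mul_eq_comp, ← Module.End.mul_eq_comp,
      hT, mul_assoc, ← map_mul]
    simp
  let v : Fin 2 → (linHom σ σ).invariants := ![⟨1, key 1 (by simp)⟩, ⟨T, key T hT⟩]
  have hv : LinearIndependent ℂ v := by
    rw [LinearIndependent.pair_iff]
    intro s t hst
    have hst' : s • (1 : Module.End ℂ V) + t • T = 0 := congrArg Subtype.val hst
    have ht : t = 0 := by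
      by_contra ht
      apply hs (-(t⁻¹ * s))
      have : t • T = -(s • 1) := by rw [eq_neg_iff_add_eq_zero, add_comm]; exact hst'
      rw [neg_smul, mul_smul, ← smul_neg, ← this, smul_smul, inv_mul_cancel₀ ht, one_smul]
    subst ht
    rw [zero_smul, add_zero, smul_eq_zero] at hst'
    exact ⟨hst'.resolve_right one_ne_zero, rfl⟩
  have := hv.fintype_card_le_finrank
  simpa [multHom] using this

include hirr hdist hcompl in
lemma mk_omega {V : Type} [AddCommGroup V] [Module ℂ V] [FiniteDimensional ℂ V]
    (ρ : Representation ℂ G V) (hV : Module.finrank ℂ V ≠ 0)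
    (hsym : ∀ i j, multHom ((Irr i).tprod ρ) (Irr j) = multHom ((Irr j).tprod ρ) (Irr i))
    (hle : ∀ i j, multHom ((Irr i).tprod ρ) (Irr j) ≤ 1)
    (z : G) (w : ℂ) (hz : ρ z = w • 1) : w = 1 ∨ w = -1 := by
  obtain ⟨i₀, hd, hi₀⟩ := mk_triv W Irr hcompl
  have h1 : 1 ≤ multHom ((Irr i₀).tprod ρ) ((Irr i₀).tprod ρ) :=
    mk_one_le (by rw [Module.finrank_tensorProduct, hd, one_mul]; exact hV) _
  rw [mk_sq W Irr hirr hdist hcompl] at h1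
  obtain ⟨j, -, hj⟩ := Finset.exists_ne_zero_of_sum_ne_zero (Nat.pos_iff_ne_zero.1 h1)
  have hj1 : multHom ((Irr i₀).tprod ρ) (Irr j) = 1 := by
    have := hle i₀ j
    interval_cases h : multHom ((Irr i₀).tprod ρ) (Irr j)
    · simp at hj
    · rfl
  have hj2 := hj1
  rw [hsym] at hj2
  obtain ⟨f, -, hs, hf⟩ := mk_hom _ _ (hirr j) hj1
  have hjz : Irr j z = w • 1 := by
    refine LinearMap.ext fun u => ?_
    obtain ⟨v, rfl⟩ := hs u
    rw [← hf, Representation.tprod_apply, hi₀, hz, TensorProduct.map_smul_right]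
    simp [Module.End.one_eq_id]
  obtain ⟨f, h0, -, hf⟩ := mk_hom _ _ (hirr i₀) hj2
  have : w * w = 1 := by
    by_contra hne
    apply h0
    refine LinearMap.ext fun v => ?_
    have := hf z v
    rw [Representation.tprod_apply, hi₀, hz, hjz, TensorProduct.map_smul_right, TensorProduct.map_smul_left,
      smul_smul] at this
    simp only [Module.End.one_eq_id, TensorProduct.map_id, LinearMap.smul_apply, LinearMap.id_apply,
      map_smul] at this
    have h2 : (w * w - 1) • f v = 0 := by rw [sub_smul, this, one_smul, sub_self]
    exact (smul_eq_zero.1 h2).resolve_left (sub_ne_zero.2 hne)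
  exact mul_self_eq_one_iff.1 this

end
end McKay

/-- If the McKay graph `Γ(G,ρ)` of a nonzero representation `ρ` of a finite
group `G` is a tree, then `|Z(G)| = 2`, and for every non-central `g ∈ G` we have
`dim End_{C(g)}(ρ↓_{C(g)}) = 2`. -/
theorem mckay_tree_center_and_centralizers
    {G : Type} [Group G] [Fintype G]
    {V : Type} [AddCommGroup V] [Module ℂ V] [FiniteDimensional ℂ V]
    (ρ : Representation ℂ G V) (hV : Module.finrank ℂ V ≠ 0)
    {ι : Type} [Fintype ι]
    (W : ι → Type) [∀ i, AddCommGroup (W i)] [∀ i, Module ℂ (W i)]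
    [∀ i, FiniteDimensional ℂ (W i)]
    (Irr : (i : ι) → Representation ℂ G (W i))
    (hirr : ∀ i, IsIrreducibleRep (Irr i))
    (hdist : ∀ i j, RepIso (Irr i) (Irr j) → i = j)
    (hcompl : ∀ (U : Type) [AddCommGroup U] [Module ℂ U] [FiniteDimensional ℂ U]
      (σ : Representation ℂ G U), IsIrreducibleRep σ → ∃ i, RepIso σ (Irr i))
    (hsym : ∀ i j, multHom ((Irr i).tprod ρ) (Irr j) = multHom ((Irr j).tprod ρ) (Irr i))
    (hle : ∀ i j, multHom ((Irr i).tprod ρ) (Irr j) ≤ 1)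
    (hloop : ∀ i, multHom ((Irr i).tprod ρ) (Irr i) = 0)
    (htree : (SimpleGraph.fromRel fun i j => multHom ((Irr i).tprod ρ) (Irr j) = 1).IsTree) :
    Nat.card (Subgroup.center G) = 2 ∧
      ∀ g : G, g ∉ Subgroup.center G →
        multHom (ρ.comp (Subgroup.centralizer {g}).subtype)
          (ρ.comp (Subgroup.centralizer {g}).subtype) = 2 := by
  classical
  have hcomm : ∀ g : G, g ∉ Subgroup.center G → ∀ c : ℂ, ρ g ≠ c • 1 := by
    intro g hg c hc
    apply hg
    rw [Subgroup.mem_center_iff]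
    intro h
    have : ρ ((g * h)⁻¹ * (h * g)) = 1 := by
      have h1 : ρ (h * g) = ρ (g * h) := by rw [map_mul, map_mul, hc]; simp
      rw [map_mul, h1, ← map_mul]; simp
    have := mk_faithful W Irr hirr hdist hcompl ρ hsym htree _ this
    exact (inv_mul_eq_one.1 this).symm
  let E : Subgroup G → ℕ := fun K => multHom (ρ.comp K.subtype) (ρ.comp K.subtype)
  let c : G → ℕ := fun g => Nat.card (Subgroup.centralizer {g})
  let e : G → ℕ := fun g => E (Subgroup.centralizer {g})
  have hcpos : ∀ g, 0 < c g := fun g => Nat.card_pos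
  have he2 : ∀ g, g ∉ Subgroup.center G → 2 ≤ e g := by
    intro g hg
    refine mk_two_le hV _ (ρ g) ?_ (hcomm g hg)
    rintro ⟨h, hh⟩
    rw [Subgroup.mem_centralizer_singleton_iff] at hh
    change ρ h * ρ g = ρ g * ρ h
    rw [← map_mul, ← map_mul, hh]
  have hcent : ∀ g, g ∈ Subgroup.center G → Subgroup.centralizer {g} = ⊤ := by
    intro g hg
    rw [eq_top_iff]
    intro x _
    rw [Subgroup.mem_centralizer_singleton_iff]
    exact Subgroup.mem_center_iff.1 hg x
  have hC : ∀ g, g ∈ Subgroup.center G → c g = Nat.card G := fun g hg => by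
    simp only [c]; rw [hcent g hg]; simp
  have hE : ∀ g, g ∈ Subgroup.center G → e g = E ⊤ := fun g hg => congrArg E (hcent g hg)
  have hE1 : 1 ≤ E ⊤ := mk_one_le hV _
  have k1 : ∑ g, c g * e g = _ := mk_count1 W Irr hirr hdist hcompl ρ
  have k2 : ∑ g, c g = _ := mk_count2 W Irr hirr hdist hcompl
  have k3 := mk_edges (fun i j => multHom ((Irr i).tprod ρ) (Irr j)) hsym hle hloop htree
  have hn : 0 < Nat.card G := Nat.card_pos
  have hZ : Nat.card (Subgroup.center G) =
      (Finset.univ.filter (fun g => g ∈ Subgroup.center G)).card := by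
    rw [Nat.card_eq_fintype_card, Fintype.card_subtype]
  have tot : ∑ g, (c g : ℤ) * ((e g : ℤ) - 2) = - 2 * Nat.card G := by
    have k1' : ∑ g, (c g : ℤ) * (e g : ℤ) = (Nat.card G : ℤ) *
        ((∑ i, ∑ j, multHom ((Irr i).tprod ρ) (Irr j) ^ 2 : ℕ) : ℤ) := by exact_mod_cast k1
    have k2' : ∑ g, (c g : ℤ) = (Nat.card G : ℤ) * Fintype.card ι := by exact_mod_cast k2
    have k3' : ((∑ i, ∑ j, multHom ((Irr i).tprod ρ) (Irr j) ^ 2 : ℕ) : ℤ) + 2 =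
      2 * Fintype.card ι := by exact_mod_cast k3
    simp only [mul_sub, Finset.sum_sub_distrib]
    rw [k1', ← Finset.sum_mul, k2', eq_sub_of_add_eq k3']
    ring
  rw [← Finset.sum_filter_add_sum_filter_not _ (fun g => g ∈ Subgroup.center G)] at tot
  have hs1 : ∑ g ∈ Finset.univ.filter (fun g => g ∈ Subgroup.center G),
      (c g : ℤ) * ((e g : ℤ) - 2) =
      (Nat.card (Subgroup.center G) : ℤ) * (Nat.card G * ((E ⊤ : ℤ) - 2)) := by
    rw [hZ, ← nsmul_eq_mul, ← Finset.sum_const]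
    refine Finset.sum_congr rfl fun g hg => ?_
    rw [Finset.mem_filter] at hg
    rw [hC g hg.2, hE g hg.2]
  have hterm : ∀ g ∈ Finset.univ.filter (fun g => ¬ g ∈ Subgroup.center G),
      0 ≤ (c g : ℤ) * ((e g : ℤ) - 2) := by
    intro g hg
    rw [Finset.mem_filter] at hg
    have := he2 g hg.2
    apply mul_nonneg (by positivity)
    have : (2 : ℤ) ≤ e g := by exact_mod_cast this
    linarith
  have hs2 := Finset.sum_nonneg hterm
  rw [hs1] at tot
  have hnz : (0 : ℤ) < Nat.card G := by exact_mod_cast hn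
  have hm : E ⊤ = 1 := by
    by_contra hne
    have : (2 : ℤ) ≤ E ⊤ := by
      have : 2 ≤ E ⊤ := by omega
      exact_mod_cast this
    have : 0 ≤ (Nat.card (Subgroup.center G) : ℤ) * (Nat.card G * ((E ⊤ : ℤ) - 2)) :=
      mul_nonneg (by positivity) (mul_nonneg (by positivity) (by linarith))
    linarith
  rw [hm] at tot
  have hZ2 : 2 ≤ Nat.card (Subgroup.center G) := by
    have : (2 : ℤ) * Nat.card G ≤ Nat.card (Subgroup.center G) * Nat.card G := by
      push_cast at tot; nlinarith
    have := le_of_mul_le_mul_right this hnz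
    exact_mod_cast this
  have hsc : ∀ z, ∃ w : ℂ, z ∈ Subgroup.center G → ρ z = w • 1 := by
    intro z
    by_cases hz : z ∈ Subgroup.center G
    · by_contra! hcon
      have h2 : 2 ≤ E ⊤ := by
        refine mk_two_le hV _ (ρ z) ?_ (fun w => (hcon w).2)
        rintro ⟨h, hh⟩
        change ρ h * ρ z = ρ z * ρ h
        rw [← map_mul, ← map_mul, Subgroup.mem_center_iff.1 hz]
      omega
    · exact ⟨0, fun h => absurd h hz⟩
  choose w hw using hsc
  have hZle : Nat.card (Subgroup.center G) ≤ 2 := by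
    rw [hZ]
    refine (Finset.card_le_card_of_injOn w (t := {1, -1}) ?_ ?_).trans Finset.card_le_two
    · intro z hz
      have hz : z ∈ Subgroup.center G := by simpa using hz
      simpa using mk_omega W Irr hirr hdist hcompl ρ hV hsym hle z (w z) (hw z hz)
    · intro x hx y hy hxy
      have hx : x ∈ Subgroup.center G := by simpa using hx
      have hy : y ∈ Subgroup.center G := by simpa using hy
      have h1 : ρ x = ρ y := by rw [hw x hx, hw y hy, hxy]
      have : ρ (x⁻¹ * y) = 1 := by rw [map_mul, ← h1, ← map_mul]; simp
      exact inv_mul_eq_one.1 (mk_faithful W Irr hirr hdist hcompl ρ hsym htree _ this)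
  have hZe : Nat.card (Subgroup.center G) = 2 := le_antisymm hZle hZ2
  refine ⟨hZe, fun g hg => ?_⟩
  rw [hZe] at tot
  have h0 : ∑ g ∈ Finset.univ.filter (fun g => ¬ g ∈ Subgroup.center G),
      (c g : ℤ) * ((e g : ℤ) - 2) = 0 := by push_cast at tot; linarith
  have := (Finset.sum_eq_zero_iff_of_nonneg hterm).1 h0 g (by simp [hg])
  have hc0 : (c g : ℤ) ≠ 0 := by exact_mod_cast (hcpos g).ne'
  have h3 := (mul_eq_zero.1 this).resolve_left hc0
  have h4 : (e g : ℤ) = 2 := by linarith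
  exact_mod_cast h4
end

section
/- Let G be a finite group and ρ a faithful, self-dual (ρ ≅ ρ*) complex representation of G with dim ρ = 2. Then either there exists an injective group homomorphism G → SU(2) (the group of 2×2 special unitary complex matrices), or G is isomorphic to a dihedral group Dih_n (the group of order 2n of symmetries of a regular n-gon) for some n ≥ 1. -/
open scoped TensorProduct

open Matrix in
open scoped ComplexOrder MatrixOrder in
theorem aux_su2 {G : Type} [Group G] [Fintype G]
    (φ : G →* Matrix (Fin 2) (Fin 2) ℂ) (hφ : Function.Injective φ)
    (hdet : ∀ g, (φ g).det = 1) :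
    ∃ f : G →* Matrix.specialUnitaryGroup (Fin 2) ℂ, Function.Injective f := by
  classical
  have hpd : (∑ g : G, (φ g)ᴴ * φ g).PosDef := by
    apply Matrix.posDef_sum Finset.univ_nonempty
    intro g _
    rw [(Matrix.posSemidef_conjTranspose_mul_self (φ g)).posDef_iff_det_ne_zero]
    simp [Matrix.det_mul, Matrix.det_conjTranspose, hdet]
  obtain ⟨Q, hQ, hPQ⟩ := CStarAlgebra.isStrictlyPositive_iff_eq_star_mul_self.mp
        hpd.isStrictlyPositive
  have hinv : ∀ h : G, (φ h)ᴴ * (∑ g : G, (φ g)ᴴ * φ g) * φ h = ∑ g : G, (φ g)ᴴ * φ g := by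
    intro h
    rw [Finset.mul_sum, Finset.sum_mul,
      ← Equiv.sum_comp (Equiv.mulRight h) (fun g => (φ g)ᴴ * φ g)]
    refine Finset.sum_congr rfl fun g _ => ?_
    simp [Matrix.conjTranspose_mul, mul_assoc]
  rw [hPQ, Matrix.star_eq_conjTranspose] at hinv
  lift Q to (Matrix (Fin 2) (Fin 2) ℂ)ˣ using hQ
  have hu : ∀ g, (Q : Matrix (Fin 2) (Fin 2) ℂ) * φ g * (Q⁻¹ : (Matrix (Fin 2) (Fin 2) ℂ)ˣ) ∈
      Matrix.specialUnitaryGroup (Fin 2) ℂ := by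
    intro g
    rw [Matrix.mem_specialUnitaryGroup_iff, Matrix.mem_unitaryGroup_iff']
    constructor
    · have h1 := hinv g
      have h2 : ((Q⁻¹ : (Matrix (Fin 2) (Fin 2) ℂ)ˣ) : Matrix (Fin 2) (Fin 2) ℂ)ᴴ *
          (Q : Matrix (Fin 2) (Fin 2) ℂ)ᴴ = 1 := by
        rw [← Matrix.conjTranspose_mul]; simp
      rw [Matrix.star_eq_conjTranspose, Matrix.conjTranspose_mul, Matrix.conjTranspose_mul]
      calc _ = ((Q⁻¹ : (Matrix (Fin 2) (Fin 2) ℂ)ˣ) : Matrix (Fin 2) (Fin 2) ℂ)ᴴ *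
            ((φ g)ᴴ * ((Q : Matrix (Fin 2) (Fin 2) ℂ)ᴴ * (Q : Matrix (Fin 2) (Fin 2) ℂ)) * φ g) *
            (Q⁻¹ : (Matrix (Fin 2) (Fin 2) ℂ)ˣ) := by simp only [mul_assoc]
        _ = (((Q⁻¹ : (Matrix (Fin 2) (Fin 2) ℂ)ˣ) : Matrix (Fin 2) (Fin 2) ℂ)ᴴ *
          (Q : Matrix (Fin 2) (Fin 2) ℂ)ᴴ) * ((Q : Matrix (Fin 2) (Fin 2) ℂ) *
            (Q⁻¹ : (Matrix (Fin 2) (Fin 2) ℂ)ˣ)) := by rw [h1]; simp only [mul_assoc]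
        _ = 1 := by rw [h2]; simp
    · rw [Matrix.det_mul, Matrix.det_mul, hdet, mul_one, ← Matrix.det_mul]; simp
  refine ⟨⟨⟨fun g => ⟨_, hu g⟩, ?_⟩, ?_⟩, ?_⟩
  · apply Subtype.ext; simp
  · intro a b
    apply Subtype.ext
    simp [mul_assoc]
  · intro a b hab
    apply hφ
    have h1 : (Q : Matrix (Fin 2) (Fin 2) ℂ) * φ a * (Q⁻¹ : (Matrix (Fin 2) (Fin 2) ℂ)ˣ) =
        (Q : Matrix (Fin 2) (Fin 2) ℂ) * φ b * (Q⁻¹ : (Matrix (Fin 2) (Fin 2) ℂ)ˣ) :=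
      congrArg Subtype.val hab
    exact (Units.mul_right_inj Q).1 ((Units.mul_left_inj Q⁻¹).1 h1)

theorem aux_dihedral {G : Type} [Group G] [Finite G] (H : Subgroup G) (hH : IsCyclic H)
    (s : G) (hs : s ∉ H) (hidx : ∀ g, g ∉ H → s * g ∈ H) (hinv : ∀ g, g ∉ H → g * g = 1) :
    ∃ n : ℕ, 1 ≤ n ∧ Nonempty (G ≃* DihedralGroup n) := by
  refine ⟨Nat.card H, Nat.card_pos, ?_⟩
  let e := zmodCyclicMulEquiv hH
  let E : ZMod (Nat.card H) → G := fun i => (e (Multiplicative.ofAdd i) : G)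
  have hE : ∀ i, E i ∈ H := fun i => (e _).2
  have hadd : ∀ i j, E (i + j) = E i * E j := by
    intro i j; simp [E]
  have hsub : ∀ i j, E (i - j) = (E j)⁻¹ * E i := by
    intro i j
    rw [eq_inv_mul_iff_mul_eq, ← hadd]; congr 1; ring
  have hinj : ∀ i j, E i = E j → i = j := by
    intro i j h
    exact Multiplicative.ofAdd.injective (e.injective (Subtype.ext h))
  have hsE : ∀ h, h ∈ H → s * h ∉ H := fun h hh hc => hs ((H.mul_mem_cancel_right hh).1 hc)
  have hss : s * s = 1 := hinv s hs
  have hcom : ∀ h, h ∈ H → h * s = s * h⁻¹ := by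
    intro h hh
    have h1 := hinv _ (hsE h hh)
    have h2 : s⁻¹ = s := inv_eq_of_mul_eq_one_left hss
    have h3 : (s * h)⁻¹ = s * h := inv_eq_of_mul_eq_one_left h1
    have h4 : s * h * s = h⁻¹ := by rw [← h3]; simp
    rw [← h4, ← mul_assoc, ← mul_assoc, hss, one_mul]
  let F : DihedralGroup (Nat.card H) → G := fun x => match x with
    | .r i => E i
    | .sr i => s * E i
  have hFmul : ∀ x y, F (x * y) = F x * F y := by
    rintro (i | i) (j | j)
    · exact hadd i j
    · change s * E (j - i) = E i * (s * E j)
      rw [hsub, ← mul_assoc, ← mul_assoc, hcom _ (hE i)]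
    · change s * E (i + j) = s * E i * E j
      rw [hadd, mul_assoc]
    · change E (j - i) = s * E i * (s * E j)
      rw [hsub, mul_assoc s, ← mul_assoc (E i), hcom _ (hE i), ← mul_assoc, ← mul_assoc, hss,
        one_mul]
  have hF : Function.Bijective F := by
    constructor
    · rintro (i | i) (j | j) h
      · rw [hinj i j h]
      · exact absurd (show s * E j ∈ H from (show E i = s * E j from h) ▸ hE i) (hsE _ (hE j))
      · exact absurd (show s * E i ∈ H from (show s * E i = E j from h) ▸ hE j) (hsE _ (hE i))
      · rw [hinj i j (mul_left_cancel h)]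
    · have hsurj : ∀ h, h ∈ H → ∃ i, E i = h := by
        intro h hh
        obtain ⟨i, hi⟩ := e.surjective ⟨h, hh⟩
        exact ⟨Multiplicative.toAdd i, by simp [E, hi]⟩
      intro g
      by_cases hg : g ∈ H
      · obtain ⟨i, hi⟩ := hsurj g hg
        exact ⟨.r i, hi⟩
      · obtain ⟨i, hi⟩ := hsurj _ (hidx g hg)
        refine ⟨.sr i, ?_⟩
        change s * E i = g
        rw [hi, ← mul_assoc, hss, one_mul]
  exact ⟨(MulEquiv.mk (Equiv.ofBijective F hF) hFmul).symm⟩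

theorem aux_unip (M : Matrix (Fin 2) (Fin 2) ℂ) (hd : M.det = 1) (v : Fin 2 → ℂ) (hv : v ≠ 0)
    (hMv : M.mulVec v = v) (n : ℕ) (hn : n ≠ 0) (hM : M ^ n = 1) : M = 1 := by
  have h0 : (M - 1).det = 0 :=
    Matrix.exists_mulVec_eq_zero_iff.1 ⟨v, hv, by simp [Matrix.sub_mulVec, hMv]⟩
  have hsq : (M - 1) * (M - 1) = 0 := by
    rw [Matrix.det_fin_two] at h0 hd
    simp at h0
    ext i j
    fin_cases i <;> fin_cases j <;> simp [Matrix.mul_apply, Fin.sum_univ_two] <;> grind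
  have hp : ∀ k : ℕ, M ^ k = 1 + (k : ℂ) • (M - 1) := by
    intro k
    induction k with
    | zero => simp
    | succ k ih =>
      have : M ^ (k + 1) = M ^ k * (1 + (M - 1)) := by rw [pow_succ]; simp
      rw [this, ih, mul_add, add_mul, add_mul, smul_mul_assoc, smul_mul_assoc, hsq]
      push_cast
      rw [add_smul]; simp; abel
  have := hp n
  rw [hM] at this
  have h2 : (n : ℂ) • (M - 1) = 0 := by simpa using this
  rcases smul_eq_zero.1 h2 with h | h
  · exact absurd (by exact_mod_cast h) hn
  · exact sub_eq_zero.1 h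

theorem aux_cyclic {H : Type} [Group H] [Finite H]
    (φ : H →* Matrix (Fin 2) (Fin 2) ℂ) (hφ : Function.Injective φ)
    (hdet : ∀ g, (φ g).det = 1) (hcomm : ∀ a b : H, a * b = b * a) : IsCyclic H := by
  have hev : ∃ v : Fin 2 → ℂ, v ≠ 0 ∧ ∀ h, ∃ c : ℂ, (φ h).mulVec v = c • v := by
    by_cases hsc : ∀ h, ∃ c : ℂ, φ h = c • (1 : Matrix (Fin 2) (Fin 2) ℂ)
    · refine ⟨![1, 0], by simp, fun h => ?_⟩
      obtain ⟨c, hc⟩ := hsc h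
      exact ⟨c, by rw [hc, Matrix.smul_mulVec, Matrix.one_mulVec]⟩
    · push Not at hsc
      obtain ⟨h0, hh0⟩ := hsc
      obtain ⟨μ, hμ⟩ := Module.End.exists_eigenvalue (Matrix.toLin' (φ h0))
      obtain ⟨v, hv⟩ := hμ.exists_hasEigenvector
      have hv1 : (φ h0).mulVec v = μ • v := by simpa using hv.apply_eq_smul
      refine ⟨v, hv.2, fun h => ?_⟩
      have hw1 : (φ h0).mulVec ((φ h).mulVec v) = μ • (φ h).mulVec v := by
        rw [Matrix.mulVec_mulVec, ← map_mul, hcomm, map_mul, ← Matrix.mulVec_mulVec, hv1,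
          Matrix.mulVec_smul]
      have hv0 := hv.2
      generalize (φ h).mulVec v = w at *
      have hne := hh0 μ
      generalize φ h0 = A at *
      have key : v 0 * w 1 = v 1 * w 0 := by
        by_contra hd
        apply hne
        have a0 := congrFun hv1 0
        have a1 := congrFun hv1 1
        have b0 := congrFun hw1 0
        have b1 := congrFun hw1 1
        simp [Matrix.mulVec, dotProduct, Fin.sum_univ_two] at a0 a1 b0 b1
        have hd' : v 0 * w 1 - v 1 * w 0 ≠ 0 := sub_ne_zero.2 hd
        ext i j
        fin_cases i <;> fin_cases j <;> simp <;> apply mul_left_cancel₀ hd'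
        · linear_combination w 1 * a0 - v 1 * b0
        · linear_combination v 0 * b0 - w 0 * a0
        · linear_combination w 1 * a1 - v 1 * b1
        · linear_combination v 0 * b1 - w 0 * a1
      by_cases h00 : v 0 = 0
      · have h11 : v 1 ≠ 0 := by
          intro h11; apply hv0; ext i; fin_cases i <;> simp [h00, h11]
        refine ⟨w 1 / v 1, ?_⟩
        ext i; fin_cases i <;> simp <;> field_simp
        linear_combination -key
      · refine ⟨w 0 / v 0, ?_⟩
        ext i; fin_cases i <;> simp <;> field_simp
        linear_combination key
  obtain ⟨v, hv, hc⟩ := hev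
  choose c hc using hc
  have hsm : ∀ a b : ℂ, a • v = b • v → a = b := fun a b h => smul_left_injective ℂ hv h
  let χ : H →* ℂ :=
    { toFun := c
      map_one' := by apply hsm; rw [← hc]; simp
      map_mul' := by
        intro a b
        apply hsm
        rw [← hc, map_mul, ← Matrix.mulVec_mulVec, hc, Matrix.mulVec_smul, hc, smul_smul, mul_comm] }
  refine isCyclic_of_injective_ringHom χ ?_
  rw [injective_iff_map_eq_one]
  intro a ha
  apply hφ
  rw [map_one]
  refine aux_unip (φ a) (hdet a) v hv ?_ (Nat.card H) Nat.card_pos.ne' ?_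
  · rw [hc, show c a = 1 from ha, one_smul]
  · rw [← map_pow, pow_card_eq_one', map_one]

theorem aux_main {G : Type} [Group G] [Fintype G]
    (φ : G →* Matrix (Fin 2) (Fin 2) ℂ) (hφ : Function.Injective φ)
    (hdet : ∀ g, (φ g⁻¹).det = (φ g).det) (htr : ∀ g, (φ g⁻¹).trace = (φ g).trace) :
    (∃ f : G →* Matrix.specialUnitaryGroup (Fin 2) ℂ, Function.Injective f) ∨
      ∃ n : ℕ, 1 ≤ n ∧ Nonempty (G ≃* DihedralGroup n) := by
  by_cases h1 : ∀ g, (φ g).det = 1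
  · exact Or.inl (aux_su2 φ hφ h1)
  right
  push Not at h1
  obtain ⟨s, hs⟩ := h1
  have hmi : ∀ g, φ g * φ g⁻¹ = 1 := fun g => by rw [← map_mul]; simp
  have hpm : ∀ g, (φ g).det ≠ 1 → (φ g).det = -1 := by
    intro g hg
    have h2 : (φ g).det * (φ g).det = 1 := by
      have := congrArg Matrix.det (hmi g)
      rwa [Matrix.det_mul, hdet, Matrix.det_one] at this
    exact (mul_self_eq_one_iff.1 h2).resolve_left hg
  have hinv : ∀ g, (φ g).det ≠ 1 → g * g = 1 := by
    intro g hg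
    have hd := hpm g hg
    have hi : φ g⁻¹ = - (φ g).adjugate := by
      have h3 : (φ g).adjugate * (φ g * φ g⁻¹) = (φ g).adjugate := by rw [hmi, mul_one]
      rw [← mul_assoc, Matrix.adjugate_mul, hd] at h3
      rw [← h3]; simp
    have ht := htr g
    rw [hi, Matrix.adjugate_fin_two] at ht
    simp [Matrix.trace_fin_two] at ht
    apply hφ
    rw [map_mul, map_one]
    rw [Matrix.det_fin_two] at hd
    ext i j
    fin_cases i <;> fin_cases j <;> simp [Matrix.mul_apply, Fin.sum_univ_two] <;> grind
  let H : Subgroup G :=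
    { carrier := {g | (φ g).det = 1}
      one_mem' := by simp
      mul_mem' := by
        intro a b ha hb
        simp only [Set.mem_ofPred_eq] at *
        rw [map_mul, Matrix.det_mul, ha, hb, one_mul]
      inv_mem' := by
        intro a ha
        simp only [Set.mem_ofPred_eq] at *
        rw [hdet, ha] }
  have hmem : ∀ g, g ∈ H ↔ (φ g).det = 1 := fun g => Iff.rfl
  have hinvH : ∀ g, g ∉ H → g * g = 1 := fun g hg => hinv g hg
  have hsH : s ∉ H := hs
  have hconj : ∀ h, h ∈ H → s * h * s = h⁻¹ := by
    intro h hh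
    have h1 := hinvH (s * h) (fun hc => hsH ((H.mul_mem_cancel_right hh).1 hc))
    exact eq_inv_of_mul_eq_one_left (by simpa [mul_assoc] using h1)
  have hss := hinvH s hsH
  refine aux_dihedral H ?_ s hsH ?_ hinvH
  · refine aux_cyclic (φ.comp H.subtype) (hφ.comp Subtype.val_injective) (fun g => g.2) ?_
    rintro ⟨a, ha⟩ ⟨b, hb⟩
    apply Subtype.ext
    change a * b = b * a
    have hx := hconj _ (H.mul_mem hb ha)
    have e2 : s * a * s * (s * b * s) = s * (a * b) * s := by
      calc s * a * s * (s * b * s) = s * a * (s * s) * b * s := by simp only [mul_assoc]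
        _ = _ := by rw [hss]; simp only [mul_assoc, one_mul]
    rw [mul_inv_rev, ← hconj a ha, ← hconj b hb, e2] at hx
    exact (mul_left_cancel (mul_right_cancel hx)).symm
  · intro g hg
    rw [hmem, map_mul, Matrix.det_mul, hpm s hs, hpm g hg]; norm_num

/-- If a finite group `G` has a faithful self-dual 2-dimensional complex
representation, then either `G` embeds into `SU(2)`, or `G` is isomorphic to a dihedral group
`Dih_n` (of order `2n`) for some `n ≥ 1`. -/
theorem faithful_selfdual_two_dim_classification
    {G : Type} [Group G] [Fintype G]
    {V : Type} [AddCommGroup V] [Module ℂ V] [FiniteDimensional ℂ V]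
    (ρ : Representation ℂ G V) (hfaith : Function.Injective ⇑ρ)
    (hsd : RepIso ρ ρ.dual) (hdim : Module.finrank ℂ V = 2) :
    (∃ f : G →* Matrix.specialUnitaryGroup (Fin 2) ℂ, Function.Injective f) ∨
      ∃ n : ℕ, 1 ≤ n ∧ Nonempty (G ≃* DihedralGroup n) := by
  obtain ⟨e, he⟩ := hsd
  let b : Module.Basis (Fin 2) ℂ V := Module.finBasisOfFinrankEq ℂ V hdim
  let φ : G →* Matrix (Fin 2) (Fin 2) ℂ :=
    ((LinearMap.toMatrixAlgEquiv b).toMulEquiv.toMonoidHom : _ →* _).comp ρ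
  have hφa : ∀ g, φ g = LinearMap.toMatrix b b (ρ g) := fun g => rfl
  have hconj : ∀ g, e.conj (ρ g) = Module.Dual.transpose (ρ g⁻¹) := by
    intro g
    ext1 v
    rw [LinearEquiv.conj_apply_apply, he]
    simp [Representation.dual_apply]
  refine aux_main φ ((LinearMap.toMatrixAlgEquiv b).injective.comp hfaith) ?_ ?_
  · intro g
    rw [hφa, hφa, LinearMap.det_toMatrix, LinearMap.det_toMatrix, ← LinearMap.det_conj (ρ g) e]
    change _ = LinearMap.det (e.conj (ρ g))
    rw [hconj]
    exact (LinearMap.det_dualMap _).symm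
  · intro g
    rw [hφa, hφa, ← LinearMap.trace_eq_matrix_trace, ← LinearMap.trace_eq_matrix_trace,
      ← LinearMap.trace_conj' (ρ g) e, hconj]
    exact (LinearMap.trace_transpose' _).symm
end
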